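/- For i = 1,…,s let k_i ∈ ℕ, let y_i = Σ_{j≥1} y_{i,j} u_i^{-j} with y_{i,j} ∈ {0,…,u_i−1} and y_{i,k_i} > 0, let t ∈ ℕ with t ≥ k_i for all i, let v̄_i ∈ ℕ with v_i·v̄_i ≡ 1 (mod u_i^{k_i}), and let M_{i,k} ∈ ℕ satisfy M_{i,k}·Π_{j≠i} u_j^{k_j} ≡ 1 (mod u_i^{k_i}). Write U_k = Π_{i=1}^s u_i^{k_i}, ẏ_{i,k_i} = Σ_{j=1}^{k_i} σ_{i,j}^{-1}(y_{i,j})·u_i^{j−1}·v̄_i^j, and ÿ_k = Σ_{i=1}^s M_{i,k}·(U_k/u_i^{k_i})·ẏ_{i,k_i}. Then for every n ∈ ℕ₀: [φ^{Σ_i}_{u_i/v_i}(n)]_t ∈ [[y_i]_{k_i}, [y_i]_{k_i} + 1/u_i^{k_i}) for all i = 1,…,s if and only if n ≡ ÿ_k (mod U_k). -/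

import Mathlib

open Finset

/-- The auxiliary integers `z_r` in the formal `u/v`-adic expansion of an integer `z`:
`z_0 = z` and `z_{r+1} = (v·z_r − a_{r+1})/u`, where `a_{r+1} = (v·z_r) mod u` is the unique
element of `{0,…,u−1}` with `u ∣ (v·z_r − a_{r+1})`. -/
def ratZ (u v : ℕ) (z : ℤ) : ℕ → ℤ
  | 0 => z
  | r + 1 => ((v : ℤ) * ratZ u v z r - ((v : ℤ) * ratZ u v z r) % (u : ℤ)) / (u : ℤ)

/-- `ratDigit u v z r` is the digit `a_{r+1}` of the formal `u/v`-adic expansion of `z`,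
i.e. the unique element of `{0,…,u−1}` with `u ∣ (v·z_r − a_{r+1})`. -/
def ratDigit (u v : ℕ) (z : ℤ) (r : ℕ) : ℕ :=
  (((v : ℤ) * ratZ u v z r) % (u : ℤ)).toNat

/-- The generalized `u/v`-adic radical inverse function
`φ^Σ_{u/v}(n) = Σ_{r≥1} σ_r(a_r)/u^r`, where `σ r` is the permutation `σ_{r+1}` of
`{0,…,u−1}` and `a_{r+1} = ratDigit u v n r`. -/
noncomputable def ratPhi (u v : ℕ) (σ : ℕ → ℕ → ℕ) (n : ℕ) : ℝ :=
  ∑' r : ℕ, (σ r (ratDigit u v (n : ℤ) r) : ℝ) / (u : ℝ) ^ (r + 1)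

/-- The truncation `[φ^Σ_{u/v}(n)]_t = Σ_{r=1}^t σ_r(a_r)/u^r` of the generalized
`u/v`-adic radical inverse function to its first `t` prescribed digits. -/
noncomputable def ratPhiTrunc (u v : ℕ) (σ : ℕ → ℕ → ℕ) (t n : ℕ) : ℝ :=
  ∑ r ∈ Finset.range t, (σ r (ratDigit u v (n : ℤ) r) : ℝ) / (u : ℝ) ^ (r + 1)

/-- The star discrepancy `D*_N` of the first `N` points of the sequence `x` in `[0,1]^s`:
`D*_N = sup_{y ∈ (0,1]^s} |#{0 ≤ n < N : x_n^{(i)} < y^{(i)}, i=1,…,s}/N − Π_i y^{(i)}|`. -/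
noncomputable def starDisc (s N : ℕ) (x : ℕ → Fin s → ℝ) : ℝ :=
  sSup { d : ℝ | ∃ y : Fin s → ℝ, (∀ i, y i ∈ Set.Ioc (0 : ℝ) 1) ∧
    d = |(Nat.card {n : ℕ | n < N ∧ ∀ i, x n i < y i} : ℝ) / N - ∏ i, y i| }

theorem sum_div_pow_add_inv_pow_antitone {u : ℕ} (hu : 2 ≤ u) {d : ℕ → ℕ} (hd : ∀ j, d j < u) :
    Antitone fun m : ℕ =>
      ∑ j ∈ range m, (d j : ℝ) / (u : ℝ) ^ (j + 1) + 1 / (u : ℝ) ^ m := by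
  refine antitone_nat_of_succ_le fun m => ?_
  have hu0 : (0 : ℝ) < u := by exact_mod_cast (by omega : 0 < u)
  have hdm : (d m : ℝ) + 1 ≤ u := by exact_mod_cast hd m
  have h : ((d m : ℝ) + 1) / (u : ℝ) ^ (m + 1) ≤ 1 / (u : ℝ) ^ m := by
    rw [div_le_div_iff₀ (by positivity) (by positivity), pow_succ, one_mul, mul_comm]
    gcongr
  rw [sum_range_succ]
  rw [add_div] at h
  linarith

theorem sum_div_pow_monotone (u : ℕ) (d : ℕ → ℕ) :
    Monotone fun m : ℕ => ∑ j ∈ range m, (d j : ℝ) / (u : ℝ) ^ (j + 1) := by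
  refine monotone_nat_of_le_succ fun m => ?_
  rw [sum_range_succ]
  have : (0 : ℝ) ≤ (d m : ℝ) / (u : ℝ) ^ (m + 1) := by positivity
  linarith

theorem sum_div_pow_mem_Ico {u : ℕ} (hu : 2 ≤ u) {d : ℕ → ℕ} (hd : ∀ j, d j < u) {K t : ℕ}
    (hKt : K ≤ t) :
    ∑ j ∈ range t, (d j : ℝ) / (u : ℝ) ^ (j + 1) ∈
      Set.Ico (∑ j ∈ range K, (d j : ℝ) / (u : ℝ) ^ (j + 1))
        (∑ j ∈ range K, (d j : ℝ) / (u : ℝ) ^ (j + 1) + 1 / (u : ℝ) ^ K) := by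
  refine ⟨sum_div_pow_monotone u d hKt, ?_⟩
  have h := sum_div_pow_add_inv_pow_antitone hu hd hKt
  have hu0 : (0 : ℝ) < u := by exact_mod_cast (by omega : 0 < u)
  have : (0 : ℝ) < 1 / (u : ℝ) ^ t := by positivity
  simp only at h
  linarith

theorem sum_div_pow_mem_Ico_iff {u : ℕ} (hu : 2 ≤ u) {d e : ℕ → ℕ} (hd : ∀ j, d j < u)
    (he : ∀ j, e j < u) {K t : ℕ} (hKt : K ≤ t) :
    ∑ j ∈ range t, (d j : ℝ) / (u : ℝ) ^ (j + 1) ∈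
      Set.Ico (∑ j ∈ range K, (e j : ℝ) / (u : ℝ) ^ (j + 1))
        (∑ j ∈ range K, (e j : ℝ) / (u : ℝ) ^ (j + 1) + 1 / (u : ℝ) ^ K) ↔
      ∀ j < K, d j = e j := by
  constructor
  · induction K with
    | zero => simp
    | succ K ih =>
      intro h
      have hK : ∀ j < K, d j = e j :=
        ih (by omega) ⟨(sum_div_pow_monotone u e K.le_succ).trans h.1,
          h.2.trans_le (sum_div_pow_add_inv_pow_antitone hu he K.le_succ)⟩
      have hsum : ∑ j ∈ range K, (d j : ℝ) / (u : ℝ) ^ (j + 1) =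
          ∑ j ∈ range K, (e j : ℝ) / (u : ℝ) ^ (j + 1) :=
        sum_congr rfl fun j hj => by rw [hK j (mem_range.1 hj)]
      have hdI := sum_div_pow_mem_Ico hu hd hKt
      rw [sum_range_succ, hsum] at hdI
      rw [sum_range_succ] at h
      have hp : (0 : ℝ) < (u : ℝ) ^ (K + 1) := by
        have : (0 : ℝ) < u := by exact_mod_cast (by omega : 0 < u)
        positivity
      have h1 : (e K : ℝ) / (u : ℝ) ^ (K + 1) < ((d K : ℝ) + 1) / (u : ℝ) ^ (K + 1) := by
        rw [add_div]; linarith [h.1, hdI.2]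
      have h2 : (d K : ℝ) / (u : ℝ) ^ (K + 1) < ((e K : ℝ) + 1) / (u : ℝ) ^ (K + 1) := by
        rw [add_div]; linarith [h.2, hdI.1]
      rw [div_lt_div_iff_of_pos_right hp] at h1 h2
      norm_cast at h1 h2
      intro j hj
      rcases Nat.lt_succ_iff_lt_or_eq.1 hj with hj | rfl
      · exact hK j hj
      · omega
  · intro h
    have hsum : ∑ j ∈ range K, (e j : ℝ) / (u : ℝ) ^ (j + 1) =
        ∑ j ∈ range K, (d j : ℝ) / (u : ℝ) ^ (j + 1) :=
      sum_congr rfl fun j hj => by rw [h j (mem_range.1 hj)]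
    rw [hsum]
    exact sum_div_pow_mem_Ico hu hd hKt

theorem ratDigit_lt {u : ℕ} (hu : 0 < u) (v : ℕ) (z : ℤ) (r : ℕ) : ratDigit u v z r < u := by
  have h := Int.emod_lt_of_pos ((v : ℤ) * ratZ u v z r) (by exact_mod_cast hu : (0 : ℤ) < u)
  unfold ratDigit
  omega

theorem mul_ratZ {u : ℕ} (hu : 0 < u) (v : ℕ) (z : ℤ) (r : ℕ) :
    (v : ℤ) * ratZ u v z r = ratDigit u v z r + u * ratZ u v z (r + 1) := by
  have hu' : (u : ℤ) ≠ 0 := by exact_mod_cast hu.ne'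
  have h0 := Int.emod_nonneg ((v : ℤ) * ratZ u v z r) hu'
  rw [ratDigit, Int.toNat_of_nonneg h0, ratZ, Int.mul_ediv_cancel' (Int.dvd_self_sub_emod)]
  ring

theorem modEq_sum_ratDigit {u : ℕ} (hu : 0 < u) {v w K : ℕ} (hvw : v * w ≡ 1 [MOD u ^ K])
    (n : ℕ) :
    n ≡ ∑ j ∈ range K, ratDigit u v (n : ℤ) j * u ^ j * w ^ (j + 1) [MOD u ^ K] := by
  have hvw' : (v : ℤ) * w ≡ 1 [ZMOD (u : ℤ) ^ K] := by
    exact_mod_cast (Int.natCast_modEq_iff.2 hvw)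
  have key : ∀ m : ℕ, (n : ℤ) ≡ ∑ j ∈ range m, (ratDigit u v (n : ℤ) j : ℤ) * u ^ j * w ^ (j + 1)
      + u ^ m * w ^ m * ratZ u v n m [ZMOD (u : ℤ) ^ K] := by
    intro m
    induction m with
    | zero => simp [ratZ]
    | succ m ih =>
      refine ih.trans ?_
      have h := (hvw'.symm.mul_left ((u : ℤ) ^ m * w ^ m * ratZ u v n m)).add_left
        (∑ j ∈ range m, (ratDigit u v (n : ℤ) j : ℤ) * u ^ j * w ^ (j + 1))
      rw [mul_one] at h
      refine h.trans (congrArg (· % (u : ℤ) ^ K) ?_)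
      rw [sum_range_succ]
      linear_combination ((u : ℤ) ^ m * w ^ m * w) * mul_ratZ hu v n m
  rw [← Int.natCast_modEq_iff]
  push_cast
  refine (key K).trans ?_
  conv_rhs => rw [← add_zero (∑ j ∈ range K, _)]
  refine Int.ModEq.add_left _ ?_
  rw [mul_assoc]
  exact Int.modEq_zero_iff_dvd.2 (dvd_mul_right _ _)

theorem eq_of_sum_mul_pow_modEq {u : ℕ} (hu : 0 < u) {w : ℕ} (hw : Nat.Coprime u w) {a c : ℕ → ℕ}
    (ha : ∀ j, a j < u) (hc : ∀ j, c j < u) {K : ℕ}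
    (h : ∑ j ∈ range K, a j * u ^ j * w ^ (j + 1) ≡
      ∑ j ∈ range K, c j * u ^ j * w ^ (j + 1) [MOD u ^ K]) :
    ∀ j < K, a j = c j := by
  induction K with
  | zero => simp
  | succ K ih =>
    rw [sum_range_succ, sum_range_succ] at h
    have hz : ∀ b : ℕ, b * u ^ K * w ^ (K + 1) ≡ 0 [MOD u ^ K] := fun b =>
      Nat.modEq_zero_iff_dvd.2 ((dvd_mul_left _ _).mul_right _)
    have hK := ih (Nat.ModEq.add_right_cancel ((hz (a K)).trans (hz (c K)).symm)
      (h.of_dvd (pow_dvd_pow u K.le_succ)))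
    have hsum : ∑ j ∈ range K, a j * u ^ j * w ^ (j + 1) =
        ∑ j ∈ range K, c j * u ^ j * w ^ (j + 1) :=
      sum_congr rfl fun j hj => by rw [hK j (mem_range.1 hj)]
    rw [hsum] at h
    have h1 := Nat.ModEq.add_left_cancel' _ h
    have h2 : u ^ K * (a K * w ^ (K + 1)) ≡ u ^ K * (c K * w ^ (K + 1)) [MOD u ^ K * u] := by
      convert h1 using 1 <;> ring
    have h3 := Nat.ModEq.mul_left_cancel' (pow_pos hu K).ne' h2
    have h4 := (Nat.ModEq.cancel_right_of_coprime (hw.pow_right (K + 1)) h3).eq_of_lt_of_lt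
      (ha K) (hc K)
    intro j hj
    rcases Nat.lt_succ_iff_lt_or_eq.1 hj with hj | rfl
    · exact hK j hj
    · exact h4

theorem ratDigit_eq_iff_modEq {u : ℕ} (hu : 0 < u) {v w K : ℕ} (hK : 1 ≤ K)
    (hvw : v * w ≡ 1 [MOD u ^ K]) {c : ℕ → ℕ} (hc : ∀ j, c j < u) (n : ℕ) :
    (∀ j < K, ratDigit u v (n : ℤ) j = c j) ↔
      n ≡ ∑ j ∈ range K, c j * u ^ j * w ^ (j + 1) [MOD u ^ K] := by
  have hn := modEq_sum_ratDigit hu hvw n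
  constructor
  · intro h
    rwa [sum_congr rfl fun j hj => by rw [h j (mem_range.1 hj)]] at hn
  · intro h
    have hw : Nat.Coprime u w := by
      have h1 : v * w ≡ 1 [MOD u] := hvw.of_dvd (dvd_pow_self u (by omega))
      have h2 : Nat.gcd (v * w) u = 1 := by simpa using h1.gcd_eq
      exact (Nat.Coprime.coprime_mul_left h2).symm
    exact eq_of_sum_mul_pow_modEq hu hw (fun j => ratDigit_lt hu v n j) hc (hn.symm.trans h)

theorem modEq_prod_iff_of_pairwise_coprime {ι : Type*} [Fintype ι] {m : ι → ℕ}
    (hm : ∀ i j, i ≠ j → Nat.Coprime (m i) (m j)) {a b : ℕ} :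
    a ≡ b [MOD ∏ i, m i] ↔ ∀ i, a ≡ b [MOD m i] := by
  refine ⟨fun h i => h.of_dvd (dvd_prod_of_mem m (mem_univ i)), fun h => ?_⟩
  rw [Nat.modEq_iff_dvd, Nat.cast_prod]
  refine prod_dvd_of_coprime (fun i _ j _ hij => ?_) fun i _ => Nat.modEq_iff_dvd.1 (h i)
  exact Nat.isCoprime_iff_coprime.2 (hm i j hij)

theorem sum_mul_prod_erase_modEq {ι : Type*} [Fintype ι] [DecidableEq ι] {m M : ι → ℕ}
    (hM : ∀ i, M i * ∏ j ∈ univ.erase i, m j ≡ 1 [MOD m i]) (x : ι → ℕ) (i : ι) :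
    ∑ l, M l * (∏ j ∈ univ.erase l, m j) * x l ≡ x i [MOD m i] := by
  rw [← add_sum_erase _ _ (mem_univ i)]
  have h1 : M i * (∏ j ∈ univ.erase i, m j) * x i ≡ x i [MOD m i] := by
    simpa using (hM i).mul_right (x i)
  have h2 : ∑ l ∈ univ.erase i, M l * (∏ j ∈ univ.erase l, m j) * x l ≡ 0 [MOD m i] := by
    refine Nat.modEq_zero_iff_dvd.2 (dvd_sum fun l hl => ?_)
    refine ((dvd_prod_of_mem m ?_).mul_left _).mul_right _
    exact mem_erase.2 ⟨(ne_of_mem_erase hl).symm, mem_univ i⟩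
  simpa using h1.add h2

/-- **Lemma 2, item 2.** `[φ^{Σ_i}_{u_i/v_i}(n)]_t ∈ [[y_i]_{k_i}, [y_i]_{k_i} + 1/u_i^{k_i})`
for all `i = 1,…,s` iff `n ≡ ÿ_k (mod U_k)`, where
`ÿ_k = Σ_i M_{i,k}·(U_k/u_i^{k_i})·ẏ_{i,k_i}` and
`ẏ_{i,k_i} = Σ_{j=1}^{k_i} σ_{i,j}^{-1}(y_{i,j})·u_i^{j−1}·v̄_i^j`. -/
theorem halton_ratPhiTrunc_forall_mem_Ico_iff_modEq
    (s : ℕ) (hs : 1 ≤ s) (u v : Fin s → ℕ)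
    (hu : ∀ i, 2 ≤ u i) (hv : ∀ i, 1 ≤ v i)
    (huv : ∀ i, Nat.Coprime (u i) (v i))
    (hcop : ∀ i j, i ≠ j → Nat.Coprime (u i) (u j))
    (σ σinv : Fin s → ℕ → ℕ → ℕ)
    (hσ : ∀ i r, Set.BijOn (σ i r) (Set.Iio (u i)) (Set.Iio (u i)))
    (hinv : ∀ i r, Set.InvOn (σinv i r) (σ i r) (Set.Iio (u i)) (Set.Iio (u i)))
    (hinvmap : ∀ i r, Set.MapsTo (σinv i r) (Set.Iio (u i)) (Set.Iio (u i)))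
    (k : Fin s → ℕ) (hk : ∀ i, 1 ≤ k i) (t : ℕ) (hkt : ∀ i, k i ≤ t)
    (y : Fin s → ℕ → ℕ) (hy : ∀ i j, y i j < u i) (hyk : ∀ i, 0 < y i (k i - 1))
    (vbar : Fin s → ℕ) (hvbar : ∀ i, v i * vbar i ≡ 1 [MOD u i ^ k i])
    (M : Fin s → ℕ)
    (hM : ∀ i, M i * ∏ j ∈ Finset.univ.erase i, u j ^ k j ≡ 1 [MOD u i ^ k i])
    (n : ℕ) :
    (∀ i, ratPhiTrunc (u i) (v i) (σ i) t n ∈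
        Set.Ico (∑ j ∈ Finset.range (k i), (y i j : ℝ) / (u i : ℝ) ^ (j + 1))
          ((∑ j ∈ Finset.range (k i), (y i j : ℝ) / (u i : ℝ) ^ (j + 1)) +
            1 / (u i : ℝ) ^ k i)) ↔
      n ≡ ∑ i, M i * (∏ j ∈ Finset.univ.erase i, u j ^ k j) *
          (∑ j ∈ Finset.range (k i), σinv i j (y i j) * u i ^ j * vbar i ^ (j + 1))
        [MOD ∏ i, u i ^ k i] := by
  have hu0 : ∀ i, 0 < u i := fun i => by have := hu i; omega
  rw [modEq_prod_iff_of_pairwise_coprime fun i j hij => (hcop i j hij).pow (k i) (k j)]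
  refine forall_congr' fun i => ?_
  have hdig : ∀ r, ratDigit (u i) (v i) (n : ℤ) r ∈ Set.Iio (u i) :=
    fun r => ratDigit_lt (hu0 i) (v i) n r
  have hX := sum_mul_prod_erase_modEq hM
    (fun i => ∑ j ∈ Finset.range (k i), σinv i j (y i j) * u i ^ j * vbar i ^ (j + 1)) i
  rw [ratPhiTrunc, sum_div_pow_mem_Ico_iff (hu i)
    (d := fun r => σ i r (ratDigit (u i) (v i) (n : ℤ) r))
    (fun r => (hσ i r).mapsTo (hdig r)) (hy i) (hkt i)]
  have hiff : ∀ j, σ i j (ratDigit (u i) (v i) (n : ℤ) j) = y i j ↔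
      ratDigit (u i) (v i) (n : ℤ) j = σinv i j (y i j) := fun j =>
    ⟨fun h => by rw [← h, (hinv i j).1 (hdig j)], fun h => by rw [h, (hinv i j).2 (hy i j)]⟩
  simp only [hiff]
  rw [ratDigit_eq_iff_modEq (hu0 i) (hk i) (hvbar i) (c := fun j => σinv i j (y i j))
    (fun j => hinvmap i j (hy i j)) n]
  exact ⟨fun h => h.trans hX.symm, fun h => h.trans hX⟩
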